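/- Let G be a strongly connected finite directed multigraph on vertex set V. Then G is Eulerian (every vertex has indegree equal to outdegree) if and only if for every vertex s there is a group isomorphism K(G,s) ≅ ℤ^V_0 / Δℤ^V. -/

import Mathlib

open Finset

variable {V : Type} [Fintype V] [DecidableEq V]

/-- Outdegree of `v`. -/
def outdeg (d : V → V → ℕ) (v : V) : ℕ := ∑ w, d v w

/-- Indegree of `v`. -/
def indeg (d : V → V → ℕ) (v : V) : ℕ := ∑ w, d w v

/-- The graph Laplacian. -/
def lap (d : V → V → ℕ) : Matrix V V ℤ :=
  Matrix.of fun v w => if v = w then (outdeg d v : ℤ) - d v v else -(d w v : ℤ)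

/-- Strong connectivity. -/
def StronglyConnected (d : V → V → ℕ) : Prop :=
  ∀ u v : V, Relation.ReflTransGen (fun a b => 1 ≤ d a b) u v

/-- Eulerian: every vertex has indegree equal to outdegree. -/
def Eulerian (d : V → V → ℕ) : Prop := ∀ v, indeg d v = outdeg d v

/-- Reduced Laplacian with the row and column of `s` deleted. -/
def redLap (d : V → V → ℕ) (s : V) : Matrix {v : V // v ≠ s} {v : V // v ≠ s} ℤ :=
  Matrix.of fun v w => lap d v.1 w.1

/-- Number of oriented spanning trees rooted at `s` (matrix-tree theorem). -/
def kappa (d : V → V → ℕ) (s : V) : ℤ := (redLap d s).det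

/-- Pham index. -/
def phamIndex (d : V → V → ℕ) : ℤ := Finset.univ.gcd (kappa d)

/-- Integer column span of the Laplacian. -/
def lapLattice (d : V → V → ℕ) : Submodule ℤ (V → ℤ) :=
  LinearMap.range (lap d).mulVecLin

/-- Integer column span of the reduced Laplacian. -/
def redLattice (d : V → V → ℕ) (s : V) : Submodule ℤ ({v : V // v ≠ s} → ℤ) :=
  LinearMap.range (redLap d s).mulVecLin

/-- Integer vectors with coordinate sum zero. -/
def zeroSum (V : Type) [Fintype V] : Submodule ℤ (V → ℤ) where
  carrier := {f | ∑ v, f v = 0}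
  add_mem' := by
    intro a b ha hb
    simp only [Set.mem_setOf_eq] at *
    simp [Finset.sum_add_distrib, ha, hb]
  zero_mem' := by simp
  smul_mem' := by
    intro c f hf
    simp only [Set.mem_setOf_eq, Pi.smul_apply, smul_eq_mul] at *
    simp [← Finset.mul_sum, hf]

/-- The sandpile `β_s`, recording edge multiplicities out of `s`. -/
def betaS (d : V → V → ℕ) (s : V) : {v : V // v ≠ s} → ℤ := fun v => (d s v.1 : ℤ)

/-- Stable chip configuration. -/
def Stable (d : V → V → ℕ) (σ : V → ℤ) : Prop := ∀ v, σ v < (outdeg d v : ℤ)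

/-- Result of firing vertex `v`. -/
def fire (d : V → V → ℕ) (σ : V → ℤ) (v : V) : V → ℤ := fun w => σ w - lap d w v

/-- One legal firing step. -/
def LegalStep (d : V → V → ℕ) (σ τ : V → ℤ) : Prop :=
  ∃ v, (outdeg d v : ℤ) ≤ σ v ∧ τ = fire d σ v

/-- `σ` stabilizes if some legal firing sequence from `σ` ends in a stable configuration. -/
def Stabilizes (d : V → V → ℕ) (σ : V → ℤ) : Prop :=
  ∃ τ, Relation.ReflTransGen (LegalStep d) σ τ ∧ Stable d τ

/-- Legal firing sequences, recorded as lists of fired vertices. -/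
inductive LegalSeq (d : V → V → ℕ) : (V → ℤ) → List V → Prop
  | nil (σ : V → ℤ) : LegalSeq d σ []
  | cons (σ : V → ℤ) (v : V) (l : List V) :
      (outdeg d v : ℤ) ≤ σ v → LegalSeq d (fire d σ v) l → LegalSeq d σ (v :: l)

/-- Period vector. -/
def IsPeriodVec (d : V → V → ℕ) (p : V → ℕ) : Prop :=
  p ≠ 0 ∧ (lap d).mulVec (fun v => (p v : ℤ)) = 0

/-- Simple directed path from `x` to `y`, as a list of distinct vertices. -/
def IsSimplePath (d : V → V → ℕ) (x y : V) (p : List V) : Prop :=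
  p.Nodup ∧ p.head? = some x ∧ p.getLast? = some y ∧ p.Chain' (fun a b => 1 ≤ d a b)

theorem sum_lap_col (d : V → V → ℕ) (w : V) : ∑ v, lap d v w = 0 := by
  have key : ∀ v, lap d v w = (if v = w then (outdeg d w : ℤ) else 0) - d w v := by
    intro v
    by_cases h : v = w
    · subst h; simp [lap]
    · simp [lap, h]
  simp [key, Finset.sum_sub_distrib, outdeg]

theorem sum_lap_mulVec (d : V → V → ℕ) (x : V → ℤ) : ∑ v, (lap d).mulVec x v = 0 := by
  simp only [Matrix.mulVec, dotProduct]
  rw [Finset.sum_comm]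
  simp [← Finset.sum_mul, sum_lap_col]

theorem lap_mulVec_apply (d : V → V → ℕ) (x : V → ℤ) (v : V) :
    (lap d).mulVec x v = outdeg d v * x v - ∑ w, (d w v : ℤ) * x w := by
  have key : ∀ w, lap d v w * x w =
      (if v = w then (outdeg d v : ℤ) * x v else 0) - d w v * x w := by
    intro w
    by_cases h : v = w
    · subst h; simp [lap]; ring
    · simp [lap, h]
  simp [Matrix.mulVec, dotProduct, key, Finset.sum_sub_distrib]

/-- The entrywise absolute value of a kernel vector of the Laplacian is in the kernel. -/
theorem lap_mulVec_abs_eq_zero (d : V → V → ℕ) {x : V → ℤ} (hx : (lap d).mulVec x = 0) :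
    (lap d).mulVec (fun v => |x v|) = 0 := by
  have hle : ∀ v, (lap d).mulVec (fun v => |x v|) v ≤ 0 := by
    intro v
    have hv : (outdeg d v : ℤ) * x v = ∑ w, (d w v : ℤ) * x w := by
      have := congrFun hx v
      rw [lap_mulVec_apply] at this
      simpa [sub_eq_zero] using this
    rw [lap_mulVec_apply, sub_nonpos]
    calc (outdeg d v : ℤ) * |x v| = |(outdeg d v : ℤ) * x v| := by simp [abs_mul]
      _ = |∑ w, (d w v : ℤ) * x w| := by rw [hv]
      _ ≤ ∑ w, |(d w v : ℤ) * x w| := Finset.abs_sum_le_sum_abs _ _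
      _ = ∑ w, (d w v : ℤ) * |x w| := by simp [abs_mul]
  funext v
  exact (Finset.sum_eq_zero_iff_of_nonpos (fun v _ => hle v)).1 (sum_lap_mulVec d _) v
    (Finset.mem_univ v)

/-- A kernel vector of the Laplacian of a strongly connected graph vanishing somewhere is zero. -/
theorem StronglyConnected.eq_zero_of_lap_mulVec {d : V → V → ℕ} (h : StronglyConnected d)
    {x : V → ℤ} (hx : (lap d).mulVec x = 0) {s : V} (hs : x s = 0) : x = 0 := by
  have habs := lap_mulVec_abs_eq_zero d hx
  have step : ∀ a b, 1 ≤ d a b → x b = 0 → x a = 0 := by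
    intro a b hab hb
    have hsum : ∑ w, (d w b : ℤ) * |x w| = 0 := by
      have := congrFun habs b
      rw [lap_mulVec_apply] at this
      simpa [hb] using this
    have := (Finset.sum_eq_zero_iff_of_nonneg (fun w _ => by positivity)).1 hsum a
      (Finset.mem_univ a)
    rcases mul_eq_zero.1 this with h0 | h0
    · omega
    · exact abs_eq_zero.1 h0
  funext v
  exact Relation.ReflTransGen.head_induction_on (motive := fun a _ => x a = 0) (h v s) hs
    (fun hab _ hb => step _ _ hab hb)

theorem eulerian_iff_lap_mulVec_one (d : V → V → ℕ) :
    Eulerian d ↔ (lap d).mulVec 1 = 0 := by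
  simp only [funext_iff, lap_mulVec_apply, Eulerian, indeg, Pi.one_apply, mul_one, Pi.zero_apply,
    sub_eq_zero]
  refine forall_congr' fun v => ?_
  rw [← Nat.cast_sum, Nat.cast_inj, eq_comm]

/-- A strongly connected graph is Eulerian if every vertex has a kernel vector of the Laplacian
with coordinate `1` there. -/
theorem StronglyConnected.eulerian {d : V → V → ℕ} (h : StronglyConnected d)
    (hk : ∀ s, ∃ x : V → ℤ, (lap d).mulVec x = 0 ∧ x s = 1) : Eulerian d := by
  have hk' : ∀ s, ∃ x : V → ℤ, (lap d).mulVec x = 0 ∧ x s = 1 ∧ ∀ v, 0 ≤ x v := fun s =>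
    let ⟨x, hx, hs⟩ := hk s
    ⟨fun v => |x v|, lap_mulVec_abs_eq_zero d hx, by simp [hs], fun v => abs_nonneg _⟩
  rw [eulerian_iff_lap_mulVec_one]
  rcases isEmpty_or_nonempty V with hV | ⟨⟨s⟩⟩
  · exact Subsingleton.elim _ _
  obtain ⟨x, hx, hs, hpos⟩ := hk' s
  suffices x = 1 by rwa [← this]
  funext t
  obtain ⟨y, hy, ht, hypos⟩ := hk' t
  have hz : y - y s • x = 0 := by
    refine h.eq_zero_of_lap_mulVec (s := s) ?_ (by simp [hs])
    rw [Matrix.mulVec_sub, Matrix.mulVec_smul, hx, hy, smul_zero, sub_zero]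
  have hprod : y s * x t = 1 := by
    have := congrFun hz t
    simp only [Pi.sub_apply, Pi.smul_apply, smul_eq_mul, Pi.zero_apply, ht] at this
    linarith
  exact Int.eq_one_of_mul_eq_one_left (hpos t) hprod

/-- Extend a vector on `V \ {s}` by the value `c` at `s`. -/
def extendAt (s : V) (c : ℤ) (u : {v : V // v ≠ s} → ℤ) : V → ℤ :=
  fun v => if h : v = s then c else u ⟨v, h⟩

@[simp] theorem extendAt_self (s : V) (c : ℤ) (u : {v : V // v ≠ s} → ℤ) :
    extendAt s c u s = c := by simp [extendAt]

@[simp] theorem extendAt_coe (s : V) (c : ℤ) (u : {v : V // v ≠ s} → ℤ) (v : {v : V // v ≠ s}) :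
    extendAt s c u v = u v := by simp [extendAt, v.2]

theorem lap_mulVec_eq_redLap_add (d : V → V → ℕ) (s : V) (x : V → ℤ) (v : {v : V // v ≠ s}) :
    (lap d).mulVec x v = (redLap d s).mulVec (fun w => x w) v + lap d v s * x s := by
  simp only [Matrix.mulVec, dotProduct, redLap, Matrix.of_apply]
  rw [Fintype.sum_eq_add_sum_subtype_ne _ s, add_comm]

theorem eq_zero_of_sum_eq_zero {s : V} {f : V → ℤ} (hf : ∑ v, f v = 0)
    (h : ∀ v : {v : V // v ≠ s}, f v = 0) : f = 0 := by
  rw [Fintype.sum_eq_add_sum_subtype_ne _ s] at hf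
  simp only [h, Finset.sum_const_zero, add_zero] at hf
  funext v
  by_cases hv : v = s
  · rw [hv, hf]; rfl
  · exact h ⟨v, hv⟩

/-- Dropping the coordinate at `s` identifies `zeroSum V` with all vectors on `V \ {s}`. -/
noncomputable def zeroSumEquiv (s : V) : zeroSum V ≃ₗ[ℤ] ({v : V // v ≠ s} → ℤ) :=
  LinearEquiv.ofBijective ((LinearMap.funLeft ℤ ℤ Subtype.val).comp (zeroSum V).subtype) <| by
    constructor
    · rw [injective_iff_map_eq_zero]
      intro f hf
      exact Subtype.ext (eq_zero_of_sum_eq_zero f.2 (congrFun hf))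
    · intro u
      refine ⟨⟨extendAt s (-∑ v, u v) u, ?_⟩, ?_⟩
      · change ∑ v, extendAt s (-∑ v, u v) u v = 0
        rw [Fintype.sum_eq_add_sum_subtype_ne _ s]
        simp
      · funext v
        exact extendAt_coe s _ u v

/-- The Laplacian lattice inside `zeroSum V`. -/
abbrev zeroSumLattice (d : V → V → ℕ) : Submodule ℤ (zeroSum V) :=
  (lapLattice d).comap (zeroSum V).subtype

theorem redLattice_le_map (d : V → V → ℕ) (s : V) :
    redLattice d s ≤ (zeroSumLattice d).map (zeroSumEquiv s).toLinearMap := by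
  rintro _ ⟨u, rfl⟩
  refine ⟨⟨(lap d).mulVec (extendAt s 0 u), sum_lap_mulVec d _⟩, ⟨_, rfl⟩, ?_⟩
  funext v
  change (lap d).mulVec (extendAt s 0 u) v = _
  simp [lap_mulVec_eq_redLap_add]

theorem exists_kernel_of_map_le (d : V → V → ℕ) (s : V)
    (h : (zeroSumLattice d).map (zeroSumEquiv s).toLinearMap ≤ redLattice d s) :
    ∃ x : V → ℤ, (lap d).mulVec x = 0 ∧ x s = 1 := by
  obtain ⟨u, hu⟩ := h ⟨⟨(lap d).mulVec (extendAt s 1 0), sum_lap_mulVec d _⟩, ⟨_, rfl⟩, rfl⟩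
  refine ⟨extendAt s 1 0 - extendAt s 0 u, ?_, by simp⟩
  refine eq_zero_of_sum_eq_zero (s := s) (sum_lap_mulVec d _) fun v => ?_
  have h1 : (redLap d s).mulVec u v = (lap d).mulVec (extendAt s 1 0) v := congrFun hu v
  rw [Matrix.mulVec_sub, Pi.sub_apply, ← h1, lap_mulVec_eq_redLap_add]
  simp

theorem Eulerian.map_le {d : V → V → ℕ} (h : Eulerian d) (s : V) :
    (zeroSumLattice d).map (zeroSumEquiv s).toLinearMap ≤ redLattice d s := by
  rintro _ ⟨f, ⟨x, hx⟩, rfl⟩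
  refine ⟨fun v => x v - x s, ?_⟩
  have hx' : (lap d).mulVec (x - x s • 1) = f.1 := by
    rw [Matrix.mulVec_sub, Matrix.mulVec_smul, (eulerian_iff_lap_mulVec_one d).1 h, smul_zero,
      sub_zero]
    exact hx
  funext v
  change _ = f.1 v
  rw [← hx', lap_mulVec_eq_redLap_add]
  simp

/-- If `p ≤ q` have isomorphic quotients in a Noetherian module, then `p = q`. -/
theorem Submodule.eq_of_le_of_quotient_equiv {R M : Type*} [Ring R] [AddCommGroup M] [Module R M]
    [IsNoetherian R M] {p q : Submodule R M} (hpq : p ≤ q) (e : (M ⧸ p) ≃ₗ[R] (M ⧸ q)) :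
    p = q := by
  refine le_antisymm hpq fun m hm => ?_
  have hsurj : Function.Surjective (e.symm.toLinearMap.comp (Submodule.factor hpq)) :=
    e.symm.surjective.comp (Submodule.factor_surjective hpq)
  have hinj := IsNoetherian.injective_of_surjective_endomorphism _ hsurj
  rw [← Submodule.Quotient.mk_eq_zero]
  apply hinj
  have : Submodule.factor hpq (Submodule.Quotient.mk m) = 0 :=
    (Submodule.Quotient.mk_eq_zero q).2 hm
  simp [this]

theorem stmt3 (d : V → V → ℕ) (h : StronglyConnected d) :
    Eulerian d ↔ ∀ s : V, Nonempty (
      (({v : V // v ≠ s} → ℤ) ⧸ redLattice d s) ≃+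
      (↥(zeroSum V) ⧸ (lapLattice d).comap (zeroSum V).subtype)) := by
  constructor
  · intro hE s
    exact ⟨(Submodule.Quotient.equiv _ _ (zeroSumEquiv s)
      (le_antisymm (hE.map_le s) (redLattice_le_map d s))).symm.toAddEquiv⟩
  · intro H
    refine h.eulerian fun s => exists_kernel_of_map_le d s ?_
    obtain ⟨e⟩ := H s
    exact (Submodule.eq_of_le_of_quotient_equiv (redLattice_le_map d s)
      (e.toIntLinearEquiv.trans (Submodule.Quotient.equiv _ _ (zeroSumEquiv s) rfl))).ge
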